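/- arXiv:2005.05803 — 6 statements merged into one kernel-verified Lean document; each statement's English description precedes it below -/
import Mathlib

section
/- Let m ≥ 1, let λ₁, …, λₘ be real numbers, set h := λ₁ + ⋯ + λₘ, S := h² − (λ₁² + ⋯ + λₘ²), and for a fixed index i set Σ'ᵢ := Σ_{k<l, k≠i, l≠i} λₖλₗ. If h > 0 and h ≤ λᵢ, then both S/2 ≤ Σ'ᵢ and S/2 ≤ −Σ'ᵢ hold; in particular S ≤ 0. -/
/-- The square of a finite sum is the sum of the squares plus twice the sum of the products over
strictly ordered pairs. -/
theorem Finset.sum_sq_eq_sum_sq_add_two_mul_sum_lt {ι R : Type*} [LinearOrder ι] [CommRing R]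
    (s : Finset ι) (f : ι → R) :
    (∑ k ∈ s, f k) ^ 2 =
      ∑ k ∈ s, f k ^ 2 + 2 * ∑ p ∈ (s ×ˢ s).filter (fun p => p.1 < p.2), f p.1 * f p.2 := by
  have hsplit : ∀ k l, f k * f l = (if k = l then f k * f l else 0) +
      (if k < l then f k * f l else 0) + (if l < k then f l * f k else 0) := by
    intro k l
    rcases lt_trichotomy k l with hkl | rfl | hkl
    · simp [hkl, hkl.ne, hkl.not_gt]
    · simp
    · simp [hkl, hkl.ne', hkl.not_gt, mul_comm]
  have hswap : ∑ k ∈ s, ∑ l ∈ s, (if l < k then f l * f k else 0) =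
      ∑ k ∈ s, ∑ l ∈ s, (if k < l then f k * f l else 0) := Finset.sum_comm
  have hdiag : ∑ k ∈ s, ∑ l ∈ s, (if k = l then f k * f l else 0) = ∑ k ∈ s, f k ^ 2 := by
    refine Finset.sum_congr rfl fun k hk => ?_
    rw [Finset.sum_ite_eq, if_pos hk, sq]
  rw [Finset.sum_filter, Finset.sum_product, sq, Finset.sum_mul_sum,
    Finset.sum_congr rfl fun k _ => Finset.sum_congr rfl fun l _ => hsplit k l]
  simp only [Finset.sum_add_distrib]
  rw [hswap, hdiag]
  ring


/-- (Intermediate inequalities in the proof of Lemma 5.5.)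
Let `m ≥ 1`, `h := ∑ lam k`, `S := h² − ∑ (lam k)²`, and for a fixed index `i`
let `Sig := ∑_{k<l, k≠i, l≠i} lam k * lam l`. If `h > 0` and `h ≤ lam i`, then
`S/2 ≤ Sig` and `S/2 ≤ −Sig`; in particular `S ≤ 0`. -/
theorem lemm_alg_intermediate_inequalities
    (m : ℕ) (hm : 1 ≤ m) (lam : Fin m → ℝ) (i : Fin m)
    (h : ℝ) (hh : h = ∑ k, lam k)
    (S : ℝ) (hS : S = h ^ 2 - ∑ k, (lam k) ^ 2)
    (Sig : ℝ)
    (hSig : Sig = ∑ p ∈ Finset.univ.filter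
        (fun p : Fin m × Fin m => p.1 < p.2 ∧ p.1 ≠ i ∧ p.2 ≠ i),
        lam p.1 * lam p.2)
    (hhpos : 0 < h) (hle : h ≤ lam i) :
    S / 2 ≤ Sig ∧ S / 2 ≤ -Sig ∧ S ≤ 0 := by
  have hpairs : Finset.univ.filter
      (fun p : Fin m × Fin m => p.1 < p.2 ∧ p.1 ≠ i ∧ p.2 ≠ i) =
      (Finset.univ.erase i ×ˢ Finset.univ.erase i).filter (fun p => p.1 < p.2) := by
    ext p
    simp only [Finset.mem_filter, Finset.mem_univ, true_and, Finset.mem_product, Finset.mem_erase,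
      and_true]
    tauto
  have hsq := Finset.sum_sq_eq_sum_sq_add_two_mul_sum_lt (Finset.univ.erase i) lam
  rw [← hpairs, ← hSig] at hsq
  have hsum := Finset.add_sum_erase Finset.univ lam (Finset.mem_univ i)
  have hsumsq := Finset.add_sum_erase Finset.univ (fun k => lam k ^ 2) (Finset.mem_univ i)
  have hnonneg : 0 ≤ ∑ k ∈ Finset.univ.erase i, lam k ^ 2 :=
    Finset.sum_nonneg fun k _ => sq_nonneg (lam k)
  rw [← hh, ← eq_sub_iff_add_eq'] at hsum
  rw [← hsumsq] at hS
  rw [hsum] at hsq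
  have hprod : 0 ≤ h * (lam i - h) := mul_nonneg hhpos.le (sub_nonneg.mpr hle)
  refine ⟨?_, ?_, ?_⟩ <;> nlinarith
end

section
/- Let λ > 0 and let γ : ℝ → ℝ² be a unit-speed self-expanding plane curve, i.e. γ is C² with ‖γ'(t)‖ = 1 for all t and its curvature k(t) := ⟨γ''(t), ν(t)⟩ satisfies k(t) = λ⟨γ(t), ν(t)⟩ for all t, where ν(t) = (−γ'₂(t), γ'₁(t)) is the leftward unit normal. Then the function t ↦ k(t) · exp(λ‖γ(t)‖²/2) is constant on ℝ. -/
open scoped RealInnerProductSpace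

/-- The leftward unit normal `ν(t) = (−γ′₂(t), γ′₁(t))` of a unit-speed plane
curve `γ`, obtained by rotating `γ′(t)` counterclockwise by `π/2`. -/
noncomputable def expNormal (γ : ℝ → EuclideanSpace ℝ (Fin 2)) (t : ℝ) :
    EuclideanSpace ℝ (Fin 2) :=
  (WithLp.equiv 2 (Fin 2 → ℝ)).symm ![-(deriv γ t 1), deriv γ t 0]

/-- The curvature function `k(t) = ⟨γ″(t), ν(t)⟩` of a unit-speed plane curve. -/
noncomputable def curvatureFn (γ : ℝ → EuclideanSpace ℝ (Fin 2)) (t : ℝ) : ℝ :=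
  ⟪deriv (deriv γ) t, expNormal γ t⟫

/-- A unit-speed self-expanding plane curve with constant `lam`: a `C²` curve
`γ : ℝ → ℝ²` with `‖γ′(t)‖ = 1` for all `t`, whose curvature satisfies
`k(t) = lam * ⟨γ(t), ν(t)⟩` for all `t`. -/
def IsSelfExpandingCurve (lam : ℝ) (γ : ℝ → EuclideanSpace ℝ (Fin 2)) : Prop :=
  ContDiff ℝ 2 γ ∧ (∀ t, ‖deriv γ t‖ = 1) ∧
    ∀ t, curvatureFn γ t = lam * ⟪γ t, expNormal γ t⟫

/-- The inner product on `ℝ²` in coordinates. -/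
lemma inner_fin_two (u v : EuclideanSpace ℝ (Fin 2)) :
    ⟪u, v⟫ = u 0 * v 0 + u 1 * v 1 := by
  simp [PiLp.inner_apply, Fin.sum_univ_two, mul_comm]

/-- Coordinates of a differentiable curve in `ℝ²` are differentiated separately. -/
lemma hasDerivAt_coord {f : ℝ → EuclideanSpace ℝ (Fin 2)}
    {f' : EuclideanSpace ℝ (Fin 2)} {t : ℝ} (h : HasDerivAt f f' t) (i : Fin 2) :
    HasDerivAt (fun u => f u i) (f' i) t :=
  (EuclideanSpace.proj (𝕜 := ℝ) i).hasFDerivAt.comp_hasDerivAt t h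

/-- Along a unit-speed self-expanding plane curve with
constant `lam > 0`, the function `t ↦ k(t) · exp(lam‖γ(t)‖²/2)` is constant. -/
theorem curvature_mul_exp_const
    (lam : ℝ) (hlam : 0 < lam) (γ : ℝ → EuclideanSpace ℝ (Fin 2))
    (hγ : IsSelfExpandingCurve lam γ) :
    ∀ s t : ℝ,
      curvatureFn γ s * Real.exp (lam * ‖γ s‖ ^ 2 / 2) =
        curvatureFn γ t * Real.exp (lam * ‖γ t‖ ^ 2 / 2) := by
  obtain ⟨hC, hunit, hexp⟩ := hγ
  have hγ' : ∀ t, HasDerivAt γ (deriv γ t) t := fun t =>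
    (hC.differentiable (by norm_num) t).hasDerivAt
  have hγ'' : ∀ t, HasDerivAt (deriv γ) (deriv (deriv γ) t) t := fun t =>
    (hC.differentiable_deriv_two t).hasDerivAt
  have hsq : ∀ u : EuclideanSpace ℝ (Fin 2), ‖u‖ ^ 2 = u 0 * u 0 + u 1 * u 1 := fun u => by
    rw [← real_inner_self_eq_norm_sq, inner_fin_two]
  have hk : ∀ t, curvatureFn γ t = lam * (γ t 1 * deriv γ t 0 - γ t 0 * deriv γ t 1) := fun t => by
    rw [hexp, inner_fin_two]
    congr 1
    simp [expNormal]
    ring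
  have hk' : ∀ t, deriv (deriv γ) t 1 * deriv γ t 0 - deriv (deriv γ) t 0 * deriv γ t 1 =
      lam * (γ t 1 * deriv γ t 0 - γ t 0 * deriv γ t 1) := fun t => by
    rw [← hk, curvatureFn, inner_fin_two]
    simp [expNormal]
    ring
  have hone : ∀ t, deriv γ t 0 * deriv γ t 0 + deriv γ t 1 * deriv γ t 1 = 1 := fun t => by
    rw [← hsq, hunit, one_pow]
  have horth : ∀ t, deriv γ t 0 * deriv (deriv γ) t 0 +
      deriv γ t 1 * deriv (deriv γ) t 1 = 0 := fun t => by
    have h0 := hasDerivAt_coord (hγ'' t) 0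
    have h1 := hasDerivAt_coord (hγ'' t) 1
    have h := (h0.mul h0).add (h1.mul h1)
    have hc := (hasDerivAt_const t (1 : ℝ)).congr_of_eventuallyEq
      (Filter.Eventually.of_forall hone)
    have := h.unique hc
    linarith
  have hderiv : ∀ t, HasDerivAt
      (fun t => curvatureFn γ t * Real.exp (lam * ‖γ t‖ ^ 2 / 2)) 0 t := fun t => by
    simp only [hk, hsq]
    have x := hasDerivAt_coord (hγ' t) 0
    have y := hasDerivAt_coord (hγ' t) 1
    have a := hasDerivAt_coord (hγ'' t) 0
    have b := hasDerivAt_coord (hγ'' t) 1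
    refine ((((y.mul a).sub (x.mul b)).const_mul lam).mul
      (((((x.mul x).add (y.mul y)).const_mul lam).div_const 2).exp)).congr_deriv ?_
    have hk't := hk' t
    have hot := horth t
    have h1t := hone t
    simp only [Pi.mul_apply, Pi.add_apply, Pi.sub_apply]
    generalize Real.exp _ = E
    generalize deriv (deriv γ) t 0 = p at *
    generalize deriv (deriv γ) t 1 = q at *
    generalize deriv γ t 0 = a at *
    generalize deriv γ t 1 = b at *
    generalize γ t 0 = x at *
    generalize γ t 1 = y at *
    linear_combination (-E * lam * (x * a + y * b)) * hk't +
      E * lam * (x * q - y * p) * h1t + E * lam * (y * a - x * b) * hot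
  exact is_const_of_deriv_eq_zero (fun t => (hderiv t).differentiableAt)
    (fun t => (hderiv t).deriv)
end

section
/- Let λ > 0 and let γ : ℝ → ℝ² be a unit-speed self-expanding plane curve with curvature function k. If k(t₀) = 0 for some t₀ ∈ ℝ, then k(t) = 0 for all t ∈ ℝ. In particular, k never changes sign: k(s)·k(t) ≥ 0 for all s, t ∈ ℝ. -/
open scoped RealInnerProductSpace

/-- The derivative of a coordinate of a plane curve is the coordinate of the derivative. -/
theorem hasDerivAt_euclidean_apply {f : ℝ → EuclideanSpace ℝ (Fin 2)} {t : ℝ}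
    (hf : DifferentiableAt ℝ f t) (i : Fin 2) :
    HasDerivAt (fun s => f s i) (deriv f t i) t :=
  (EuclideanSpace.proj (𝕜 := ℝ) i).hasFDerivAt.comp_hasDerivAt t hf.hasDerivAt

theorem inner_expNormal (γ : ℝ → EuclideanSpace ℝ (Fin 2)) (t : ℝ)
    (v : EuclideanSpace ℝ (Fin 2)) :
    ⟪v, expNormal γ t⟫ = deriv γ t 0 * v 1 - deriv γ t 1 * v 0 := by
  simp [expNormal, PiLp.inner_apply, Fin.sum_univ_two]
  ring

/-- Along a self-expanding curve, `k` satisfies `k' = -λ k ⟨γ, γ'⟩`. -/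
theorem IsSelfExpandingCurve.hasDerivAt_curvatureFn {lam : ℝ}
    {γ : ℝ → EuclideanSpace ℝ (Fin 2)} (hγ : IsSelfExpandingCurve lam γ) (t : ℝ) :
    HasDerivAt (curvatureFn γ) (-(lam * curvatureFn γ t * ⟪γ t, deriv γ t⟫)) t := by
  obtain ⟨hC, hunit, hk⟩ := hγ
  have hd : Differentiable ℝ γ := hC.differentiable (by norm_num)
  have hd' : Differentiable ℝ (deriv γ) := hC.differentiable_deriv_two
  have h (i : Fin 2) := hasDerivAt_euclidean_apply (hd t) i
  have h' (i : Fin 2) := hasDerivAt_euclidean_apply (hd' t) i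
  have hsq (s : ℝ) : deriv γ s 0 * deriv γ s 0 + deriv γ s 1 * deriv γ s 1 = 1 := by
    have := EuclideanSpace.real_norm_sq_eq (deriv γ s)
    rw [hunit, Fin.sum_univ_two] at this
    linarith
  have horth : deriv γ t 0 * deriv (deriv γ) t 0 + deriv γ t 1 * deriv (deriv γ) t 1 = 0 := by
    have h₁ := ((h' 0).mul (h' 0)).add ((h' 1).mul (h' 1))
    have h₂ := h₁.unique ((hasDerivAt_const t (1 : ℝ)).congr_of_eventuallyEq
      (Filter.Eventually.of_forall hsq))
    linarith
  have hfun : curvatureFn γ =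
      fun s => lam * (deriv γ s 0 * γ s 1 - deriv γ s 1 * γ s 0) := by
    funext s
    rw [hk, inner_expNormal]
  have hcurv : curvatureFn γ t =
      deriv γ t 0 * deriv (deriv γ) t 1 - deriv γ t 1 * deriv (deriv γ) t 0 :=
    inner_expNormal γ t _
  rw [hcurv, hfun]
  refine ((((h' 0).mul (h 1)).sub ((h' 1).mul (h 0))).const_mul lam).congr_deriv ?_
  have hin : ⟪γ t, deriv γ t⟫ = deriv γ t 0 * γ t 0 + deriv γ t 1 * γ t 1 := by
    simp [PiLp.inner_apply, Fin.sum_univ_two]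
  rw [hin]
  linear_combination
    lam * (γ t 0 * deriv (deriv γ) t 1 - γ t 1 * deriv (deriv γ) t 0) * hsq t
    + lam * (γ t 1 * deriv γ t 0 - γ t 0 * deriv γ t 1) * horth

/-- The quantity `k e^{λ‖γ‖²/2}` is constant along a self-expanding curve. -/
theorem IsSelfExpandingCurve.curvatureFn_mul_exp_eq {lam : ℝ}
    {γ : ℝ → EuclideanSpace ℝ (Fin 2)} (hγ : IsSelfExpandingCurve lam γ) (s t : ℝ) :
    curvatureFn γ s * Real.exp (lam * ‖γ s‖ ^ 2 / 2) =
      curvatureFn γ t * Real.exp (lam * ‖γ t‖ ^ 2 / 2) := by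
  have hderiv (r : ℝ) :
      HasDerivAt (fun r => curvatureFn γ r * Real.exp (lam * ‖γ r‖ ^ 2 / 2)) 0 r := by
    have hd : HasDerivAt γ (deriv γ r) r := (hγ.1.differentiable (by norm_num) r).hasDerivAt
    refine ((hγ.hasDerivAt_curvatureFn r).mul
      ((hd.norm_sq.const_mul lam).div_const 2).exp).congr_deriv ?_
    ring
  exact is_const_of_deriv_eq_zero (fun r => (hderiv r).differentiableAt)
    (fun r => (hderiv r).deriv) s t

/-- If the curvature of a unit-speed self-expanding plane
curve vanishes at one point, it vanishes identically; in particular the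
curvature never changes sign. -/
theorem curvature_eq_zero_of_eq_zero_at_point
    (lam : ℝ) (hlam : 0 < lam) (γ : ℝ → EuclideanSpace ℝ (Fin 2))
    (hγ : IsSelfExpandingCurve lam γ) :
    (∀ t₀ : ℝ, curvatureFn γ t₀ = 0 → ∀ t : ℝ, curvatureFn γ t = 0) ∧
      ∀ s t : ℝ, 0 ≤ curvatureFn γ s * curvatureFn γ t := by
  refine ⟨fun t₀ h₀ t => ?_, fun s t => ?_⟩
  · have h := hγ.curvatureFn_mul_exp_eq t t₀
    rw [h₀, zero_mul] at h
    exact (mul_eq_zero.mp h).resolve_right (Real.exp_ne_zero _)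
  · have h := hγ.curvatureFn_mul_exp_eq s t
    have hs := Real.exp_pos (lam * ‖γ s‖ ^ 2 / 2)
    refine nonneg_of_mul_nonneg_left (b := Real.exp (lam * ‖γ s‖ ^ 2 / 2)) ?_ hs
    rw [mul_right_comm, h, mul_right_comm]
    exact mul_nonneg (mul_self_nonneg _) (Real.exp_nonneg _)
end

section
/- Let λ > 0 and let γ : ℝ → ℝ² be a unit-speed self-expanding plane curve with curvature function k. Then k(t) → 0 as t → +∞ and as t → −∞. -/
open scoped RealInnerProductSpace

/-- A function whose derivative `p` grows at least linearly with slope `1` lies above the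
parabola `f 0 + p 0 * t + t ^ 2 / 2`. -/
theorem parabola_le_of_monotone_sub_id {f p : ℝ → ℝ} (hf : ∀ t, HasDerivAt f (p t) t)
    (hp : Monotone fun t => p t - t) (t : ℝ) : f 0 + p 0 * t + t ^ 2 / 2 ≤ f t := by
  have hd : ∀ s, HasDerivAt (fun s => f s - s ^ 2 / 2 - p 0 * s) (p s - s - p 0) s := by
    intro s
    have h := ((hf s).sub (((hasDerivAt_id s).pow 2).div_const 2)).sub
      ((hasDerivAt_id s).const_mul (p 0))
    refine h.congr_deriv ?_
    simp
  have hc : Continuous fun s => f s - s ^ 2 / 2 - p 0 * s :=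
    continuous_iff_continuousAt.2 fun s => (hd s).continuousAt
  rcases lt_trichotomy t 0 with ht | rfl | ht
  · obtain ⟨c, hc, h⟩ := exists_hasDerivAt_eq_slope _ _ ht hc.continuousOn fun s _ => hd s
    have hm := hp hc.2.le
    rw [eq_div_iff (by linarith)] at h
    simp only at hm h
    nlinarith
  · simp
  · obtain ⟨c, hc, h⟩ := exists_hasDerivAt_eq_slope _ _ ht hc.continuousOn fun s _ => hd s
    have hm := hp hc.1.le
    rw [eq_div_iff (by linarith)] at h
    simp only at hm h
    nlinarith

/-- If `f' = p`, `p' = 1 + lam * n ^ 2` and `n' = -(lam * n * p)` with `lam > 0`, then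
`n` tends to `0` at both ends of the real line, since `n * exp (lam * f)` is constant. -/
theorem tendsto_zero_of_support_function_system {lam : ℝ} (hlam : 0 < lam) {f p n : ℝ → ℝ}
    (hf : ∀ t, HasDerivAt f (p t) t) (hp : ∀ t, HasDerivAt p (1 + lam * n t ^ 2) t)
    (hn : ∀ t, HasDerivAt n (-(lam * n t * p t)) t) :
    Filter.Tendsto n Filter.atTop (nhds 0) ∧ Filter.Tendsto n Filter.atBot (nhds 0) := by
  have hmono : Monotone fun t => p t - t :=
    monotone_of_hasDerivAt_nonneg (fun t => (hp t).sub (hasDerivAt_id t)) fun t => by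
      simp only [add_sub_cancel_left]
      positivity
  have hconst : ∀ t, n t = n 0 * Real.exp (lam * f 0) * Real.exp (-(lam * f t)) := by
    intro t
    have hd : ∀ s, HasDerivAt (fun s => n s * Real.exp (lam * f s)) 0 s := fun s =>
      ((hn s).mul ((hf s).const_mul lam).exp).congr_deriv (by ring)
    have h := is_const_of_deriv_eq_zero (fun s => (hd s).differentiableAt)
      (fun s => (hd s).deriv) t 0
    rw [← h, mul_assoc, ← Real.exp_add]
    simp
  have hlim : ∀ l : Filter ℝ, Filter.Tendsto f l Filter.atTop → Filter.Tendsto n l (nhds 0) := by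
    intro l hl
    have h := (Real.tendsto_exp_neg_atTop_nhds_zero.comp (hl.const_mul_atTop hlam)).const_mul
      (n 0 * Real.exp (lam * f 0))
    rw [mul_zero] at h
    exact h.congr fun t => (hconst t).symm
  have hpar := parabola_le_of_monotone_sub_id hf hmono
  constructor
  · refine hlim _ (Filter.tendsto_atTop_mono (f := fun t => t + (f 0 - (p 0 - 1) ^ 2 / 2))
      (fun t => ?_) (Filter.tendsto_atTop_add_const_right _ _ Filter.tendsto_id))
    nlinarith [hpar t, sq_nonneg (t + (p 0 - 1))]
  · refine hlim _ (Filter.tendsto_atTop_mono (f := fun t => -t + (f 0 - (p 0 + 1) ^ 2 / 2))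
      (fun t => ?_) (Filter.tendsto_atTop_add_const_right _ _ Filter.tendsto_neg_atBot_atTop))
    nlinarith [hpar t, sq_nonneg (t + (p 0 + 1))]

/-- The curvature of a unit-speed self-expanding plane curve
tends to `0` as `t → +∞` and as `t → −∞`. -/
theorem curvature_tendsto_zero
    (lam : ℝ) (hlam : 0 < lam) (γ : ℝ → EuclideanSpace ℝ (Fin 2))
    (hγ : IsSelfExpandingCurve lam γ) :
    Filter.Tendsto (curvatureFn γ) Filter.atTop (nhds 0) ∧
      Filter.Tendsto (curvatureFn γ) Filter.atBot (nhds 0) := by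
  obtain ⟨hsmooth, hunit, hcurv⟩ := hγ
  have hcoord : ∀ {c : ℝ → EuclideanSpace ℝ (Fin 2)}, Differentiable ℝ c → ∀ (i : Fin 2) t,
      HasDerivAt (fun s => c s i) (deriv c t i) t := fun hc i t =>
    (EuclideanSpace.proj (𝕜 := ℝ) i).hasFDerivAt.comp_hasDerivAt t (hc t).hasDerivAt
  have hγ' := hcoord (hsmooth.differentiable (by norm_num))
  have hγ'' := hcoord
    ((contDiff_succ_iff_deriv (n := 1)).1 (by simpa [one_add_one_eq_two] using hsmooth)
      |>.2.2.differentiable (by norm_num))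
  have hsq : ∀ t, deriv γ t 0 ^ 2 + deriv γ t 1 ^ 2 = 1 := fun t => by
    have h := EuclideanSpace.norm_sq_eq (deriv γ t)
    simpa [hunit t, Fin.sum_univ_two] using h.symm
  have horth : ∀ t, deriv γ t 0 * deriv (deriv γ) t 0 + deriv γ t 1 * deriv (deriv γ) t 1 = 0 := by
    intro t
    have h := ((hγ'' 0 t).pow 2).add ((hγ'' 1 t).pow 2)
    have h' := h.unique ((hasDerivAt_const t (1 : ℝ)).congr_of_eventuallyEq
      (Filter.Eventually.of_forall hsq))
    norm_num at h'
    linarith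
  set n : ℝ → ℝ := fun t => γ t 1 * deriv γ t 0 - γ t 0 * deriv γ t 1 with hn
  have hk : ∀ t, curvatureFn γ t = lam * n t := fun t => by
    rw [hcurv t]
    congr 1
    simp [expNormal, PiLp.inner_apply, Fin.sum_univ_two, hn]
    ring
  have hk' : ∀ t, deriv (deriv γ) t 1 * deriv γ t 0 - deriv (deriv γ) t 0 * deriv γ t 1
      = lam * n t := fun t => by
    rw [← hk t]
    simp [curvatureFn, expNormal, PiLp.inner_apply, Fin.sum_univ_two]
    ring
  have hx : ∀ t, deriv (deriv γ) t 0 = -(lam * n t * deriv γ t 1) := fun t => by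
    linear_combination (-deriv (deriv γ) t 0) * hsq t + deriv γ t 0 * horth t
      - deriv γ t 1 * hk' t
  have hy : ∀ t, deriv (deriv γ) t 1 = lam * n t * deriv γ t 0 := fun t => by
    linear_combination (-deriv (deriv γ) t 1) * hsq t + deriv γ t 1 * horth t
      + deriv γ t 0 * hk' t
  have hlim := tendsto_zero_of_support_function_system hlam
    (f := fun t => (γ t 0 ^ 2 + γ t 1 ^ 2) / 2)
    (p := fun t => γ t 0 * deriv γ t 0 + γ t 1 * deriv γ t 1) (n := n)
    (fun t => ((((hγ' 0 t).pow 2).add ((hγ' 1 t).pow 2)).div_const 2).congr_deriv (by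
      norm_num
      ring))
    (fun t => (((hγ' 0 t).mul (hγ'' 0 t)).add ((hγ' 1 t).mul (hγ'' 1 t))).congr_deriv (by
      rw [hx, hy]
      have hnt : n t = γ t 1 * deriv γ t 0 - γ t 0 * deriv γ t 1 := rfl
      linear_combination hsq t - lam * n t * hnt))
    (fun t => (((hγ' 1 t).mul (hγ'' 0 t)).sub ((hγ' 0 t).mul (hγ'' 1 t))).congr_deriv (by
      rw [hx, hy]
      ring))
  rw [funext hk]
  constructor
  · simpa using hlim.1.const_mul lam
  · simpa using hlim.2.const_mul lam
end

section
/- Let λ > 0 and let γ : ℝ → ℝ² be a unit-speed self-expanding plane curve with curvature function k. Then k is integrable on ℝ, i.e. the total curvature ∫_ℝ |k(t)| dt is finite. -/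
open scoped RealInnerProductSpace

/-- Coordinate form of the integrability statement: the support function `y x' - x y'` of a
unit-speed curve `(x, y)` with `y'' x' - x'' y' = lam * (y x' - x y')` is integrable. -/
theorem integrable_support_of_selfExpanding {lam : ℝ} (hlam : 0 < lam)
    {x y x' y' x'' y'' : ℝ → ℝ}
    (hx : ∀ t, HasDerivAt x (x' t) t) (hy : ∀ t, HasDerivAt y (y' t) t)
    (hx' : ∀ t, HasDerivAt x' (x'' t) t) (hy' : ∀ t, HasDerivAt y' (y'' t) t)
    (hunit : ∀ t, x' t ^ 2 + y' t ^ 2 = 1)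
    (hk : ∀ t, y'' t * x' t - x'' t * y' t = lam * (y t * x' t - x t * y' t)) :
    MeasureTheory.Integrable (fun t => y t * x' t - x t * y' t) := by
  set g : ℝ → ℝ := fun t => y t * x' t - x t * y' t with hg_def
  set f : ℝ → ℝ := fun t => x t * x' t + y t * y' t with hf_def
  have horth : ∀ t, x' t * x'' t + y' t * y'' t = 0 := by
    intro t
    have h1 : HasDerivAt (fun s => x' s ^ 2 + y' s ^ 2)
        (2 * (x' t * x'' t + y' t * y'' t)) t := by
      refine (((hx' t).pow 2).add ((hy' t).pow 2)).congr_deriv ?_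
      norm_num
      ring
    have h2 : HasDerivAt (fun s => x' s ^ 2 + y' s ^ 2) 0 t := by
      simp_rw [hunit]
      exact hasDerivAt_const t 1
    linarith [h1.unique h2]
  have hx2 : ∀ t, x'' t = -(lam * g t) * y' t := fun t => by
    simp only [hg_def]
    linear_combination (-x'' t) * hunit t + x' t * horth t - y' t * hk t
  have hy2 : ∀ t, y'' t = lam * g t * x' t := fun t => by
    simp only [hg_def]
    linear_combination (-y'' t) * hunit t + y' t * horth t + x' t * hk t
  have hf : ∀ t, HasDerivAt f (1 + lam * g t ^ 2) t := fun t => by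
    refine (((hx t).mul (hx' t)).add ((hy t).mul (hy' t))).congr_deriv ?_
    rw [hx2, hy2]
    simp only [hg_def]
    linear_combination hunit t
  have hg : ∀ t, HasDerivAt g (-(lam * f t * g t)) t := fun t => by
    refine (((hy t).mul (hx' t)).sub ((hx t).mul (hy' t))).congr_deriv ?_
    rw [hx2, hy2]
    simp only [hf_def]
    ring
  have hr : ∀ t, HasDerivAt (fun s => x s ^ 2 + y s ^ 2) (2 * f t) t := fun t => by
    refine (((hx t).pow 2).add ((hy t).pow 2)).congr_deriv ?_
    simp only [hf_def]
    norm_num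
    ring
  obtain ⟨C, hC⟩ : ∃ C, ∀ t, g t * Real.exp (lam / 2 * (x t ^ 2 + y t ^ 2)) = C := by
    have hd : ∀ t, HasDerivAt (fun s => g s * Real.exp (lam / 2 * (x s ^ 2 + y s ^ 2))) 0 t :=
      fun t => by
        refine ((hg t).mul ((hr t).const_mul (lam / 2)).exp).congr_deriv ?_
        ring
    exact ⟨_, fun t => is_const_of_deriv_eq_zero (fun s => (hd s).differentiableAt)
      (fun s => (hd s).deriv) t 0⟩
  have hmono : Monotone (fun t => f t - t) := by
    have hd : ∀ t, HasDerivAt (fun s => f s - s) (lam * g t ^ 2) t := fun t =>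
      ((hf t).sub (hasDerivAt_id t)).congr_deriv (by ring)
    refine monotone_of_deriv_nonneg (fun t => (hd t).differentiableAt) fun t => ?_
    rw [(hd t).deriv]
    positivity
  have hgrowth : ∀ t, t ^ 2 / 2 - f 0 ^ 2 ≤ x t ^ 2 + y t ^ 2 := fun t => by
    have h1 : f t ^ 2 ≤ x t ^ 2 + y t ^ 2 := by
      have h : x t ^ 2 + y t ^ 2 = f t ^ 2 + g t ^ 2 := by
        simp only [hf_def, hg_def]
        linear_combination (-(x t ^ 2 + y t ^ 2)) * hunit t
      nlinarith [sq_nonneg (g t)]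
    have h2 : t ^ 2 ≤ (f t - f 0) ^ 2 := by
      rcases le_total 0 t with ht | ht
      · have := hmono ht
        simp only at this
        nlinarith
      · have := hmono ht
        simp only at this
        nlinarith
    nlinarith [sq_nonneg (f t + f 0)]
  have hgauss : MeasureTheory.Integrable
      (fun t : ℝ => |C| * Real.exp (lam / 2 * f 0 ^ 2) * Real.exp (-(lam / 4) * t ^ 2)) :=
    (integrable_exp_neg_mul_sq (by positivity)).const_mul _
  have hcont : Continuous g := continuous_iff_continuousAt.2 fun t => (hg t).continuousAt
  refine hgauss.mono' hcont.aestronglyMeasurable (Filter.Eventually.of_forall fun t => ?_)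
  have hgt : g t = C * Real.exp (-(lam / 2 * (x t ^ 2 + y t ^ 2))) := by
    rw [← hC t, mul_assoc, ← Real.exp_add, add_neg_cancel, Real.exp_zero, mul_one]
  rw [hgt, Real.norm_eq_abs, abs_mul, Real.abs_exp, mul_assoc, ← Real.exp_add]
  gcongr
  nlinarith [mul_le_mul_of_nonneg_left (hgrowth t) hlam.le]

/-- The curvature of a unit-speed self-expanding plane curve
is integrable on `ℝ`: the total curvature `∫ |k|` is finite. -/
theorem curvature_integrable
    (lam : ℝ) (hlam : 0 < lam) (γ : ℝ → EuclideanSpace ℝ (Fin 2))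
    (hγ : IsSelfExpandingCurve lam γ) :
    MeasureTheory.Integrable (curvatureFn γ) := by
  obtain ⟨hC2, hunit, hk⟩ := hγ
  have hd : ∀ t, HasDerivAt γ (deriv γ t) t := fun t =>
    (hC2.differentiable (by norm_num) t).hasDerivAt
  have hd' : ∀ t, HasDerivAt (deriv γ) (deriv (deriv γ) t) t := fun t =>
    (hC2.differentiable_deriv_two t).hasDerivAt
  have hcoord : ∀ {φ : ℝ → EuclideanSpace ℝ (Fin 2)} {v : EuclideanSpace ℝ (Fin 2)} {t : ℝ}
      (i : Fin 2), HasDerivAt φ v t → HasDerivAt (fun s => φ s i) (v i) t := fun i h =>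
    (EuclideanSpace.proj (𝕜 := ℝ) i).hasFDerivAt.comp_hasDerivAt _ h
  have hinner : ∀ (v : EuclideanSpace ℝ (Fin 2)) (t : ℝ),
      ⟪v, expNormal γ t⟫ = v 1 * deriv γ t 0 - v 0 * deriv γ t 1 := fun v t => by
    simp [expNormal, PiLp.inner_apply, Fin.sum_univ_two]
    ring
  have hcurv : curvatureFn γ =
      fun t => lam * (γ t 1 * deriv γ t 0 - γ t 0 * deriv γ t 1) := by
    funext t
    rw [hk, hinner]
  rw [hcurv]
  refine (integrable_support_of_selfExpanding hlam (fun t => hcoord 0 (hd t))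
    (fun t => hcoord 1 (hd t)) (fun t => hcoord 0 (hd' t)) (fun t => hcoord 1 (hd' t))
    (fun t => ?_) (fun t => ?_)).const_mul lam
  · have h := EuclideanSpace.real_norm_sq_eq (deriv γ t)
    rw [hunit, Fin.sum_univ_two] at h
    linarith
  · rw [← hinner, ← hinner, ← hk, curvatureFn]
end

section
/- Let λ > 0, n ≥ 1, let I ⊆ ℝ be an open interval containing 0, and let γ : I → ℝⁿ be a C² curve satisfying the self-expander ODE γ''(t) = λ(γ(t) − ⟨γ(t), γ'(t)⟩ γ'(t)) for all t ∈ I, with γ(0) = p and γ'(0) = w where ‖w‖ = 1. Then γ(t) lies in the linear span of {p, w} for every t ∈ I. In particular, if p and w are linearly independent, the solution is a planar curve in the plane spanned by p and w. -/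
open scoped RealInnerProductSpace

/-- Grönwall uniqueness to the right of the initial time. -/
theorem eq_zero_right_of_norm_deriv_le {E : Type*} [NormedAddCommGroup E] [NormedSpace ℝ E]
    {x x' : ℝ → E} {K : ℝ → ℝ} {a b : ℝ} (hK : ContinuousOn K (Set.Icc a b))
    (hx : ∀ t ∈ Set.Icc a b, HasDerivAt x (x' t) t)
    (hbound : ∀ t ∈ Set.Icc a b, ‖x' t‖ ≤ K t * ‖x t‖) (ha : x a = 0) :
    ∀ t ∈ Set.Icc a b, x t = 0 := by
  obtain ⟨C, hC⟩ := isCompact_Icc.bddAbove_image hK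
  refine eq_zero_of_abs_deriv_le_mul_abs_self_of_eq_zero_right (f' := x') (K := C)
    (fun t ht => (hx t ht).continuousAt.continuousWithinAt)
    (fun t ht => (hx t (Set.Ico_subset_Icc_self ht)).hasDerivWithinAt) ha fun t ht => ?_
  have ht' := Set.Ico_subset_Icc_self ht
  exact (hbound t ht').trans
    (mul_le_mul_of_nonneg_right (hC (Set.mem_image_of_mem K ht')) (norm_nonneg _))

/-- Grönwall uniqueness on an interval containing the initial time. -/
theorem eq_zero_of_norm_deriv_le {E : Type*} [NormedAddCommGroup E] [NormedSpace ℝ E]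
    {x x' : ℝ → E} {K : ℝ → ℝ} {I : Set ℝ} {t₀ : ℝ} (hI : I.OrdConnected) (h₀ : t₀ ∈ I)
    (hK : ContinuousOn K I) (hx : ∀ t ∈ I, HasDerivAt x (x' t) t)
    (hbound : ∀ t ∈ I, ‖x' t‖ ≤ K t * ‖x t‖) (hx₀ : x t₀ = 0) :
    ∀ t ∈ I, x t = 0 := by
  intro t ht
  rcases le_total t₀ t with h | h
  · have hsub : Set.Icc t₀ t ⊆ I := hI.out h₀ ht
    exact eq_zero_right_of_norm_deriv_le (hK.mono hsub) (fun s hs => hx s (hsub hs))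
      (fun s hs => hbound s (hsub hs)) hx₀ t ⟨h, le_rfl⟩
  · have hsub : Set.MapsTo (fun s : ℝ => -s) (Set.Icc (-t₀) (-t)) I := fun s hs =>
      hI.out ht h₀ ⟨by linarith [hs.2], by linarith [hs.1]⟩
    have key := eq_zero_right_of_norm_deriv_le (x := fun s => x (-s)) (x' := fun s => -x' (-s))
      (hK.comp continuous_neg.continuousOn hsub)
      (fun s hs => by
        simpa [Function.comp_def] using (hx _ (hsub hs)).scomp s (hasDerivAt_neg s))
      (fun s hs => by simpa using hbound _ (hsub hs)) (by simpa using hx₀)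
      (-t) ⟨by linarith, le_rfl⟩
    simpa using key

/-- A solution of a scalar linear second-order homogeneous ODE with continuous coefficients
vanishes if its initial data do. -/
theorem eq_zero_of_linear_second_order {y y' b c : ℝ → ℝ} {I : Set ℝ} {t₀ : ℝ}
    (hI : I.OrdConnected) (h₀ : t₀ ∈ I) (hb : ContinuousOn b I) (hc : ContinuousOn c I)
    (hy : ∀ t ∈ I, HasDerivAt y (y' t) t)
    (hy' : ∀ t ∈ I, HasDerivAt y' (b t * y t + c t * y' t) t)
    (hy₀ : y t₀ = 0) (hy'₀ : y' t₀ = 0) : ∀ t ∈ I, y t = 0 := by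
  intro t ht
  have key := eq_zero_of_norm_deriv_le (x := fun s => (y s, y' s)) (K := fun s => 1 + |b s| + |c s|)
    hI h₀ ((continuousOn_const.add hb.abs).add hc.abs)
    (fun s hs => (hy s hs).prodMk (hy' s hs)) (fun s _ => ?_) (by simp [hy₀, hy'₀]) t ht
  · exact congrArg Prod.fst key
  · have h₁ : |y s| ≤ ‖(y s, y' s)‖ := norm_fst_le (y s, y' s)
    have h₂ : |y' s| ≤ ‖(y s, y' s)‖ := norm_snd_le (y s, y' s)
    have hb₁ := mul_le_mul_of_nonneg_left h₁ (abs_nonneg (b s))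
    have hc₂ := mul_le_mul_of_nonneg_left h₂ (abs_nonneg (c s))
    refine norm_prod_le_iff.2 ⟨?_, ?_⟩
    · have := mul_nonneg (abs_nonneg (b s)) (norm_nonneg (y s, y' s))
      have := mul_nonneg (abs_nonneg (c s)) (norm_nonneg (y s, y' s))
      simp only [Real.norm_eq_abs]
      linarith
    · have := abs_add_le (b s * y s) (c s * y' s)
      rw [abs_mul, abs_mul] at this
      have := norm_nonneg (y s, y' s)
      simp only [Real.norm_eq_abs]
      linarith

/-- Solutions of the self-expander ODE
`γ″ = lam (γ − ⟨γ, γ′⟩ γ′)` on an open interval `I ∋ 0`, with `γ(0) = p`,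
`γ′(0) = w`, `‖w‖ = 1`, stay in the linear span of `{p, w}`; in particular,
if `p` and `w` are linearly independent then the solution is a planar curve
in the plane they span. -/
theorem self_expander_ode_solution_planar
    (lam : ℝ) (hlam : 0 < lam) (n : ℕ) (hn : 1 ≤ n)
    (I : Set ℝ) (hIopen : IsOpen I) (hIconn : I.OrdConnected) (h0 : (0 : ℝ) ∈ I)
    (γ : ℝ → EuclideanSpace ℝ (Fin n)) (hγ : ContDiffOn ℝ 2 γ I)
    (hode : ∀ t ∈ I, deriv (deriv γ) t =
      lam • (γ t - ⟪γ t, deriv γ t⟫ • deriv γ t))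
    (p w : EuclideanSpace ℝ (Fin n))
    (hp : γ 0 = p) (hw : deriv γ 0 = w) (hwnorm : ‖w‖ = 1) :
    ∀ t ∈ I, γ t ∈ Submodule.span ℝ ({p, w} : Set (EuclideanSpace ℝ (Fin n))) := by
  have hd : ∀ t ∈ I, HasDerivAt γ (deriv γ t) t := fun t ht =>
    ((hγ.differentiableOn (by norm_num)).differentiableAt (hIopen.mem_nhds ht)).hasDerivAt
  have hγ' : ContDiffOn ℝ 1 (deriv γ) I := hγ.deriv_of_isOpen hIopen (by norm_num)
  have hd' : ∀ t ∈ I, HasDerivAt (deriv γ) (deriv (deriv γ) t) t := fun t ht =>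
    ((hγ'.differentiableOn (by norm_num)).differentiableAt (hIopen.mem_nhds ht)).hasDerivAt
  intro t ht
  rw [← Submodule.orthogonal_orthogonal (Submodule.span ℝ {p, w}), Submodule.mem_orthogonal]
  intro v hv
  have hvp : ⟪v, p⟫ = 0 :=
    Submodule.inner_left_of_mem_orthogonal (Submodule.subset_span (by simp)) hv
  have hvw : ⟪v, w⟫ = 0 :=
    Submodule.inner_left_of_mem_orthogonal (Submodule.subset_span (by simp)) hv
  refine eq_zero_of_linear_second_order (y := fun s => ⟪v, γ s⟫) (y' := fun s => ⟪v, deriv γ s⟫)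
    (b := fun _ => lam) (c := fun s => -(lam * ⟪γ s, deriv γ s⟫)) hIconn h0 continuousOn_const
    (continuousOn_const.mul (hγ.continuousOn.inner hγ'.continuousOn)).neg
    (fun s hs => ?_) (fun s hs => ?_) (by simpa [hp] using hvp) (by simpa [hw] using hvw) t ht
  · simpa using (hasDerivAt_const s v).inner ℝ (hd s hs)
  · refine ((hasDerivAt_const s v).inner ℝ (hd' s hs)).congr_deriv ?_
    rw [hode s hs, inner_zero_left, inner_smul_right, inner_sub_right, inner_smul_right]
    ring
end
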